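/- In the setting of ℝ^d: let C ⊆ ℝ^d be a cone with nonempty interior, F₀ : ℝ^d → ℝ^d a C¹ map with DF₀(x) strongly positive for all x, pointwise dissipative with attractor A, and F : [−ε₀,ε₀] × ℝ^d → ℝ^d a C¹ map. Let B₁ ⊃ A be an open ball. Then there exists η > 0 such that whenever sup{‖F_ε x − F₀ x‖ + ‖DF_ε(x) − DF₀(x)‖ : ε ∈ [−ε₀,ε₀], x ∈ B₁} < η, there exist a compact domain M whose interior contains A, an integer q > 0, and ε₁ > 0 such that for each ε ∈ (−ε₁,ε₁), F_ε^q(M) ⊆ M and the set {x ∈ M : λ_max(x,F_ε) > 0} has Lebesgue measure zero in M. -/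

import Mathlib

open Filter Topology MeasureTheory Set Bornology Metric
open scoped ENNReal NNReal

noncomputable section

section Defs

variable {X : Type*} [NormedAddCommGroup X] [NormedSpace ℝ X]

/-- A cone in a Banach space: a closed convex set with `r • C ⊆ C` for all `r > 0`
and `C ∩ (-C) = {0}`. -/
def IsCone (C : Set X) : Prop :=
  IsClosed C ∧ Convex ℝ C ∧ (∀ r : ℝ, 0 < r → ∀ x ∈ C, r • x ∈ C) ∧ C ∩ (-C) = {0}

/-- `(X, C)` is strongly ordered: `C` is a cone with nonempty interior. -/
def StronglyOrderedCone (C : Set X) : Prop :=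
  IsCone C ∧ (interior C).Nonempty

/-- `x < y` in the order induced by the cone `C`. -/
def coneLT (C : Set X) (x y : X) : Prop := y - x ∈ C \ {0}

/-- `x ≤ y` in the order induced by the cone `C`. -/
def coneLE (C : Set X) (x y : X) : Prop := y - x ∈ C

/-- `x ≪ y` in the order induced by the cone `C`. -/
def coneLLT (C : Set X) (x y : X) : Prop := y - x ∈ interior C

/-- A bounded linear operator is strongly positive (w.r.t. the cone `C`) if
`T v ≫ 0` whenever `v > 0`. -/
def StronglyPositive (C : Set X) (T : X →L[ℝ] X) : Prop :=
  ∀ v : X, v ∈ C \ {0} → T v ∈ interior C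

/-- A map between normed spaces is compact if it sends bounded sets to relatively
compact sets. -/
def IsCompactMap {Y Z : Type*} [NormedAddCommGroup Y] [NormedAddCommGroup Z]
    (f : Y → Z) : Prop :=
  ∀ B : Set Y, IsBounded B → IsCompact (closure (f '' B))

/-- `h` is pointwise dissipative: some nonempty bounded set `B` attracts every point. -/
def PointwiseDissipative (h : X → X) : Prop :=
  ∃ B : Set X, B.Nonempty ∧ IsBounded B ∧
    ∀ x : X, Tendsto (fun n : ℕ => infDist (h^[n] x) B) atTop (nhds 0)

/-- The set `A` attracts the set `B` under iteration of `h`. -/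
def AttractsSet (h : X → X) (A B : Set X) : Prop :=
  ∀ ε : ℝ, 0 < ε → ∃ N : ℕ, ∀ n : ℕ, N ≤ n → ∀ x ∈ B, infDist (h^[n] x) A < ε

/-- `A` is an attractor of `h`: the maximal compact invariant set attracting every
bounded set. -/
def IsAttractor (h : X → X) (A : Set X) : Prop :=
  A.Nonempty ∧ IsCompact A ∧ h '' A = A ∧
    (∀ B : Set X, IsBounded B → AttractsSet h A B) ∧
    (∀ A' : Set X, IsCompact A' → h '' A' = A' → A' ⊆ A)

/-- The ω-limit set `ω(x,h) = ⋂ₖ closure {hⁿ x : n ≥ k}`. -/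
def omegaMap (h : X → X) (x : X) : Set X :=
  ⋂ k : ℕ, closure {y : X | ∃ n : ℕ, k ≤ n ∧ y = h^[n] x}

/-- The largest Lyapunov exponent `λ_max(x,h) = liminf (log ‖Dhⁿ(x)‖)/n` (in `EReal`). -/
def lambdaMax (h : X → X) (x : X) : EReal :=
  atTop.liminf fun n : ℕ => ((Real.log ‖fderiv ℝ (h^[n]) x‖ / n : ℝ) : EReal)

/-- The principal Lyapunov exponent `λ₁(x,h) = limsup (log ‖Dhⁿ(x)‖)/n` (in `EReal`). -/
def lambdaOne (h : X → X) (x : X) : EReal :=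
  atTop.limsup fun n : ℕ => ((Real.log ‖fderiv ℝ (h^[n]) x‖ / n : ℝ) : EReal)

/-- `S` is a linearly stable cycle of `h` of minimal period `p`: `S` is the orbit of a
`p`-periodic point `z` with spectral radius of `Dhᵖ(z)` at most `1`. -/
def IsLinStableCycle (h : X → X) (p : ℕ) (S : Set X) : Prop :=
  ∃ z : X, h^[p] z = z ∧ (∀ l : ℕ, 0 < l → l < p → h^[l] z ≠ z) ∧
    spectralRadius ℝ (fderiv ℝ (h^[p]) z) ≤ 1 ∧ S = {y : X | ∃ n : ℕ, y = h^[n] z}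

/-- `S` is a linearly stable cycle of `h` of minimal period at most `m`. -/
def IsLinStableCycleLe (h : X → X) (m : ℕ) (S : Set X) : Prop :=
  ∃ p : ℕ, 0 < p ∧ p ≤ m ∧ IsLinStableCycle h p S

/-- Semiflow axioms for `Φ : ℝ → X → X` (restricted to nonnegative times). -/
def IsSemiflow (Φ : ℝ → X → X) : Prop :=
  (∀ x : X, Φ 0 x = x) ∧
    (∀ s t : ℝ, 0 ≤ s → 0 ≤ t → ∀ x : X, Φ (t + s) x = Φ t (Φ s x)) ∧
    ContinuousOn (fun p : ℝ × X => Φ p.1 p.2) (Ici (0 : ℝ) ×ˢ (univ : Set X))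

/-- The ω-limit set of `x` under a semiflow. -/
def omegaFlow (Φ : ℝ → X → X) (x : X) : Set X :=
  ⋂ s : ℝ, closure {y : X | ∃ t : ℝ, s ≤ t ∧ y = Φ t x}

/-- The largest Lyapunov exponent of `x` w.r.t. a semiflow. -/
def lambdaMaxFlow (Φ : ℝ → X → X) (x : X) : EReal :=
  atTop.liminf fun t : ℝ => ((Real.log ‖fderiv ℝ (Φ t) x‖ / t : ℝ) : EReal)

/-- The principal Lyapunov exponent of `x` w.r.t. a semiflow. -/
def lambdaOneFlow (Φ : ℝ → X → X) (x : X) : EReal :=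
  atTop.limsup fun t : ℝ => ((Real.log ‖fderiv ℝ (Φ t) x‖ / t : ℝ) : EReal)

end Defs

section Shy

variable {X : Type*} [NormedAddCommGroup X] [NormedSpace ℝ X] [MeasurableSpace X]

/-- A Borel set `W` is shy if there is a nonzero compactly supported Borel measure `μ`
with `μ(x + W) = 0` for every `x`. -/
def IsShy (W : Set X) : Prop :=
  MeasurableSet W ∧
    ∃ μ : Measure X, μ ≠ 0 ∧ (∃ K : Set X, IsCompact K ∧ μ Kᶜ = 0) ∧
      ∀ x : X, μ ((fun w => x + w) '' W) = 0

/-- `W` is prevalent in `V` if `V \ W` is shy. -/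
def IsPrevalentIn (V W : Set X) : Prop := IsShy (V \ W)

end Shy

section Cone

variable {E : Type*} [NormedAddCommGroup E] [NormedSpace ℝ E]

lemma IsCone.zero_mem {C : Set E} (hC : IsCone C) : (0 : E) ∈ C := by
  have h : (0 : E) ∈ C ∩ (-C) := by rw [hC.2.2.2]; rfl
  exact h.1

lemma IsCone.add_mem {C : Set E} (hC : IsCone C) {x y : E} (hx : x ∈ C) (hy : y ∈ C) :
    x + y ∈ C := by
  have h := hC.2.2.1 2 two_pos _
    (hC.2.1 hx hy (by norm_num : (0 : ℝ) ≤ 1 / 2) (by norm_num : (0 : ℝ) ≤ 1 / 2) (by norm_num))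
  convert h using 1
  rw [smul_add, smul_smul, smul_smul]
  norm_num

/-- Every nonzero element of a cone is detected by a nonnegative functional. -/
lemma IsCone.exists_nonneg_functional_pos {C : Set E} (hC : IsCone C) {u : E} (hu : u ∈ C)
    (hu0 : u ≠ 0) : ∃ f : E →L[ℝ] ℝ, (∀ b ∈ C, 0 ≤ f b) ∧ 0 < f u := by
  have hnot : -u ∉ C := by
    intro h
    have h' : u ∈ C ∩ (-C) := ⟨hu, h⟩
    rw [hC.2.2.2] at h'
    exact hu0 h'
  obtain ⟨f, s, hs, hf⟩ := geometric_hahn_banach_point_closed hC.2.1 hC.1 hnot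
  have hs0 : s < 0 := by simpa using hf 0 hC.zero_mem
  refine ⟨f, fun b hb => ?_, ?_⟩
  · by_contra! hneg
    have h := hf _ (hC.2.2.1 (s / f b) (div_pos_of_neg_of_neg hs0 hneg) b hb)
    rw [map_smul, smul_eq_mul, div_mul_cancel₀ _ hneg.ne] at h
    exact lt_irrefl _ h
  · rw [map_neg] at hs
    linarith

/-- In finite dimension, a cone admits a continuous functional dominating the norm on it. -/
lemma IsCone.exists_norm_le_functional [FiniteDimensional ℝ E] {C : Set E} (hC : IsCone C) :
    ∃ l : E →L[ℝ] ℝ, ∀ w ∈ C, ‖w‖ ≤ l w := by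
  have hK : IsCompact (C ∩ sphere (0 : E) 1) := by
    have := FiniteDimensional.proper ℝ E
    exact (isCompact_sphere (0 : E) 1).inter_left hC.1
  obtain ⟨f, hf, hfK⟩ : ∃ f : E →L[ℝ] ℝ, (∀ b ∈ C, 0 ≤ f b) ∧
      ∀ u ∈ C ∩ sphere (0 : E) 1, 0 < f u := by
    suffices h : ∃ f : E →L[ℝ] ℝ, (∀ b ∈ C, 0 ≤ f b) ∧
        ∀ u ∈ C ∩ sphere (0 : E) 1, u ∈ C → 0 < f u by
      obtain ⟨f, hf, hu⟩ := h
      exact ⟨f, hf, fun u hu' => hu u hu' hu'.1⟩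
    refine hK.induction_on (p := fun s => ∃ f : E →L[ℝ] ℝ, (∀ b ∈ C, 0 ≤ f b) ∧
      ∀ u ∈ s, u ∈ C → 0 < f u) ⟨0, by simp, by simp⟩ ?_ ?_ ?_
    · rintro s t hst ⟨f, hf, h⟩
      exact ⟨f, hf, fun u hu => h u (hst hu)⟩
    · rintro s t ⟨f, hf, h⟩ ⟨g, hg, h'⟩
      refine ⟨f + g, fun b hb => add_nonneg (hf b hb) (hg b hb), ?_⟩
      rintro u (hu | hu) huC
      · exact add_pos_of_pos_of_nonneg (h u hu huC) (hg u huC)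
      · exact add_pos_of_nonneg_of_pos (hf u huC) (h' u hu huC)
    · rintro u ⟨huC, hu1⟩
      have hu0 : u ≠ 0 := by
        rintro rfl
        simp at hu1
      obtain ⟨f, hf, hfu⟩ := hC.exists_nonneg_functional_pos huC hu0
      exact ⟨{y | 0 < f y}, mem_nhdsWithin_of_mem_nhds
        ((isOpen_lt continuous_const f.continuous).mem_nhds hfu), f, hf, fun y hy _ => hy⟩
  obtain ⟨m, hm, hfm⟩ : ∃ m : ℝ, 0 < m ∧ ∀ u ∈ C ∩ sphere (0 : E) 1, m ≤ f u :=
    hK.exists_forall_le' f.continuous.continuousOn hfK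
  refine ⟨m⁻¹ • f, fun w hw => ?_⟩
  rcases eq_or_ne w 0 with rfl | hw0
  · simp
  have hn : 0 < ‖w‖ := norm_pos_iff.2 hw0
  have h := hfm (‖w‖⁻¹ • w) ⟨hC.2.2.1 _ (inv_pos.2 hn) _ hw, by
    simp [norm_smul, hn.ne']⟩
  rw [map_smul, smul_eq_mul, inv_mul_eq_div, le_div_iff₀ hn] at h
  change ‖w‖ ≤ m⁻¹ * f w
  rw [inv_mul_eq_div, le_div_iff₀ hm]
  linarith

/-- The norm of a cone-preserving operator is controlled by its value at an interior vector. -/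
lemma exists_opNorm_le_of_mapsTo {C : Set E} {v : E} (hv : v ∈ interior C) {l : E →L[ℝ] ℝ}
    (hl : ∀ w ∈ C, ‖w‖ ≤ l w) :
    ∃ K : ℝ, 0 < K ∧ ∀ T : E →L[ℝ] E, MapsTo T C C → ‖T‖ ≤ K * l (T v) := by
  obtain ⟨ρ, hρ, hball⟩ := Metric.isOpen_iff.1 isOpen_interior v hv
  refine ⟨3 * (2 / ρ), by positivity, fun T hT => ?_⟩
  have hTv : ‖T v‖ ≤ l (T v) := hl _ (hT (interior_subset hv))
  have hTv0 : 0 ≤ l (T v) := (norm_nonneg _).trans hTv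
  refine ContinuousLinearMap.opNorm_le_of_shell hρ (by positivity) (c := (2 : ℝ)) (by norm_num)
    fun w hw1 hw2 => ?_
  have hp : v + w ∈ C := interior_subset (hball (by simpa [mem_ball, dist_eq_norm] using hw2))
  have hm : v - w ∈ C := interior_subset (hball (by simpa [mem_ball, dist_eq_norm] using hw2))
  have h1 := hl _ (hT hp)
  have h2 := (norm_nonneg _).trans (hl _ (hT hm))
  have h3 : ‖T w‖ ≤ ‖T (v + w)‖ + ‖T v‖ := by
    have : T w = T (v + w) - T v := by simp
    rw [this]
    exact norm_sub_le _ _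
  simp only [map_add, map_sub] at h1 h2 h3
  have h4 : ‖T w‖ ≤ 3 * l (T v) := by linarith
  have h5 : 1 ≤ 2 / ρ * ‖w‖ := by
    rw [Real.norm_of_nonneg (by norm_num : (0 : ℝ) ≤ 2)] at hw1
    calc (1 : ℝ) = 2 / ρ * (ρ / 2) := by field_simp
      _ ≤ 2 / ρ * ‖w‖ := by gcongr
  nlinarith

/-- Near a compact family of strongly positive operators, all operators preserve the cone. -/
lemma exists_mapsTo_cone_of_close [FiniteDimensional ℝ E] {C : Set E} (hC : IsCone C)
    {D : E → E →L[ℝ] E} (hD : Continuous D) {K : Set E} (hK : IsCompact K)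
    (hpos : ∀ x ∈ K, StronglyPositive C (D x)) :
    ∃ η : ℝ, 0 < η ∧ ∀ x ∈ K, ∀ T : E →L[ℝ] E, ‖T - D x‖ < η → MapsTo T C C := by
  have := FiniteDimensional.proper ℝ E
  have hS : IsCompact (C ∩ sphere (0 : E) 1) := (isCompact_sphere (0 : E) 1).inter_left hC.1
  have hne : ∀ u ∈ C ∩ sphere (0 : E) 1, u ∈ C \ {0} := by
    rintro u ⟨hu, hu1⟩
    refine ⟨hu, ?_⟩
    rintro rfl
    simp at hu1
  have hI : IsCompact ((fun p : E × E => D p.1 p.2) '' (K ×ˢ (C ∩ sphere (0 : E) 1))) :=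
    (hK.prod hS).image ((hD.comp continuous_fst).clm_apply continuous_snd)
  obtain ⟨η, hη, hsub⟩ := hI.exists_thickening_subset_open isOpen_interior (by
    rintro _ ⟨⟨x, u⟩, ⟨hx, hu⟩, rfl⟩
    exact hpos x hx u (hne u hu))
  refine ⟨η, hη, fun x hx T hT w hw => ?_⟩
  rcases eq_or_ne w 0 with rfl | hw0
  · simpa using hC.zero_mem
  have hn : 0 < ‖w‖ := norm_pos_iff.2 hw0
  have hu : ‖w‖⁻¹ • w ∈ C ∩ sphere (0 : E) 1 :=
    ⟨hC.2.2.1 _ (inv_pos.2 hn) _ hw, by simp [norm_smul, hn.ne']⟩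
  have hTu : T (‖w‖⁻¹ • w) ∈ C := by
    refine interior_subset (hsub (Metric.mem_thickening_iff.2
      ⟨D x (‖w‖⁻¹ • w), ⟨(x, ‖w‖⁻¹ • w), ⟨hx, hu⟩, rfl⟩, ?_⟩))
    rw [dist_eq_norm, ← sub_apply]
    refine ((T - D x).le_opNorm _).trans_lt ?_
    rwa [mem_sphere_zero_iff_norm.1 hu.2, mul_one]
  have h := hC.2.2.1 _ hn _ hTu
  rwa [map_smul, smul_smul, mul_inv_cancel₀ hn.ne', one_smul] at h

end Cone

section Exponent

variable {E : Type*} [NormedAddCommGroup E] [NormedSpace ℝ E]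

lemma lambdaMax_nonpos_of_eventually_le {G : E → E} {x : E} {K : ℝ}
    (h : ∀ᶠ n : ℕ in atTop, ‖fderiv ℝ (G^[n]) x‖ ≤ K * ((n : ℝ) + 1) ^ 2) :
    lambdaMax G x ≤ 0 := by
  set K' : ℝ := max K 1
  have hK' : 1 ≤ K' := le_max_right _ _
  have hlim : Tendsto (fun n : ℕ => (Real.log (K' * ((n : ℝ) + 1) ^ 2) / n : ℝ)) atTop (𝓝 0) := by
    have hlog : Tendsto (fun n : ℕ => Real.log ((n : ℝ) + 1) / n) atTop (𝓝 0) := by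
      have h1 : Tendsto (fun y : ℝ => Real.log (y + 1) / y) atTop (𝓝 0) := by
        have h0 := (Real.tendsto_pow_log_div_mul_add_atTop 1 (-1) 1 one_ne_zero).comp
          (tendsto_atTop_add_const_right atTop (1 : ℝ) tendsto_id)
        refine h0.congr fun y => ?_
        simp
      exact h1.comp tendsto_natCast_atTop_atTop
    have hconst : Tendsto (fun n : ℕ => Real.log K' / (n : ℝ)) atTop (𝓝 0) :=
      tendsto_const_nhds.div_atTop tendsto_natCast_atTop_atTop
    have hsum := hconst.add (hlog.const_mul 2)
    rw [mul_zero, add_zero] at hsum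
    refine hsum.congr fun n => ?_
    have hn : (0 : ℝ) < (n : ℝ) + 1 := by positivity
    rw [Real.log_mul (by positivity) (by positivity), Real.log_pow]
    push_cast
    ring
  have hlim' : Tendsto (fun n : ℕ => ((Real.log (K' * ((n : ℝ) + 1) ^ 2) / n : ℝ) : EReal))
      atTop (𝓝 ((0 : ℝ) : EReal)) := (continuous_coe_real_ereal.tendsto 0).comp hlim
  rw [EReal.coe_zero] at hlim'
  rw [← hlim'.liminf_eq]
  refine liminf_le_liminf ?_
  filter_upwards [h] with n hn
  rw [EReal.coe_le_coe_iff]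
  refine div_le_div_of_nonneg_right ?_ n.cast_nonneg
  have hn1 : 1 ≤ ((n : ℝ) + 1) ^ 2 := one_le_pow₀ (by linarith [n.cast_nonneg (α := ℝ)])
  have hb : 1 ≤ K' * ((n : ℝ) + 1) ^ 2 := one_le_mul_of_one_le_of_one_le hK' hn1
  rcases (norm_nonneg (fderiv ℝ (G^[n]) x)).eq_or_lt with h0 | h0
  · rw [← h0, Real.log_zero]
    exact Real.log_nonneg hb
  · refine Real.log_le_log h0 (hn.trans ?_)
    gcongr
    exact le_max_left _ _

lemma contDiff_one_iterate {G : E → E} (hG : ContDiff ℝ 1 G) (n : ℕ) :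
    ContDiff ℝ 1 (G^[n]) := by
  induction n with
  | zero => exact contDiff_id
  | succ n ih =>
    rw [Function.iterate_succ']
    exact hG.comp ih

lemma mapsTo_fderiv_iterate {G : E → E} (hG : Differentiable ℝ G) {C : Set E} {x : E}
    (h : ∀ k : ℕ, MapsTo (fderiv ℝ G (G^[k] x)) C C) (n : ℕ) :
    MapsTo (fderiv ℝ (G^[n]) x) C C := by
  induction n with
  | zero =>
    intro w hw
    simpa using hw
  | succ n ih =>
    rw [Function.iterate_succ', fderiv_comp x (hG _) ((hG.iterate n) x)]
    exact (h n).comp ih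

/-- If nonnegative continuous derivatives have uniformly bounded integrals on `[a, b]`, then at
almost every point they grow at most quadratically. -/
lemma ae_eventually_lt_of_integral_le {a b B : ℝ} (hab : a ≤ b) {g : ℕ → ℝ → ℝ}
    (hg : ∀ n, Continuous (g n)) (hg0 : ∀ n, ∀ t ∈ Ioc a b, 0 ≤ g n t)
    (hB : ∀ n, ∫ t in a..b, g n t ≤ B) :
    ∀ᵐ t ∂(volume.restrict (Ioc a b)), ∀ᶠ n : ℕ in atTop, g n t < ((n : ℝ) + 1) ^ 2 := by
  have hmeas : ∀ n : ℕ, (volume.restrict (Ioc a b)) {t | ((n : ℝ) + 1) ^ 2 ≤ g n t} ≤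
      ENNReal.ofReal (B / ((n : ℝ) + 1) ^ 2) := by
    intro n
    have h := mul_meas_ge_le_integral_of_nonneg (μ := volume.restrict (Ioc a b)) (f := g n)
      ((ae_restrict_iff' measurableSet_Ioc).2 (Eventually.of_forall (hg0 n)))
      ((hg n).integrableOn_Ioc) (((n : ℝ) + 1) ^ 2)
    rw [← intervalIntegral.integral_of_le hab] at h
    have h' := h.trans (hB n)
    have hpos : (0 : ℝ) < ((n : ℝ) + 1) ^ 2 := by positivity
    rw [mul_comm, ← le_div_iff₀ hpos] at h'
    rw [← ENNReal.ofReal_toReal (measure_ne_top (volume.restrict (Ioc a b)) _)]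
    exact ENNReal.ofReal_le_ofReal h'
  have hsum : Summable fun n : ℕ => B / ((n : ℝ) + 1) ^ 2 := by
    have h := ((summable_nat_add_iff 1).2
      (Real.summable_one_div_nat_pow.2 (by norm_num : 1 < 2))).mul_left B
    refine h.congr fun n => ?_
    push_cast
    ring
  have hfin : ∑' n : ℕ, (volume.restrict (Ioc a b)) {t | ((n : ℝ) + 1) ^ 2 ≤ g n t} ≠ ⊤ :=
    ne_top_of_le_ne_top hsum.tsum_ofReal_ne_top (ENNReal.tsum_le_tsum hmeas)
  filter_upwards [ae_eventually_notMem hfin] with t ht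
  filter_upwards [ht] with n hn
  exact not_le.1 hn

/-- A `C¹` map whose derivative preserves a cone along bounded orbits has no observable chaos:
almost every point of an open set with uniformly bounded orbits has `λ_max ≤ 0`. -/
theorem volume_lambdaMax_pos_eq_zero [FiniteDimensional ℝ E] [MeasurableSpace E] [BorelSpace E]
    {μ : Measure E} [μ.IsAddHaarMeasure] {C : Set E} (hC : StronglyOrderedCone C) {G : E → E}
    (hG : ContDiff ℝ 1 G) {W O : Set E} (hW : IsOpen W) (hO : IsBounded O)
    (horb : ∀ x ∈ W, ∀ k : ℕ, G^[k] x ∈ O) (hpos : ∀ x ∈ O, MapsTo (fderiv ℝ G x) C C) :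
    μ {x | x ∈ W ∧ 0 < lambdaMax G x} = 0 := by
  have := FiniteDimensional.proper ℝ E
  obtain ⟨hC, v, hv⟩ := hC
  obtain ⟨l, hl⟩ := hC.exists_norm_le_functional
  obtain ⟨K, hK, hnorm⟩ := exists_opNorm_le_of_mapsTo hv hl
  obtain ⟨R, hR⟩ := hO.exists_norm_le
  have hcont : ∀ n, Continuous (fderiv ℝ (G^[n])) := fun n =>
    (contDiff_one_iterate hG n).continuous_fderiv one_ne_zero
  have hdiff : Differentiable ℝ G := hG.differentiable one_ne_zero
  have hmaps : ∀ x ∈ W, ∀ n, MapsTo (fderiv ℝ (G^[n]) x) C C := fun x hx n =>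
    mapsTo_fderiv_iterate hdiff (fun k => hpos _ (horb x hx k)) n
  let S : Set E := {x | ∀ᶠ n : ℕ in atTop, l (fderiv ℝ (G^[n]) x v) < ((n : ℝ) + 1) ^ 2}
  have hfcont : ∀ n, Continuous fun x => l (fderiv ℝ (G^[n]) x v) := fun n =>
    l.continuous.comp ((hcont n).clm_apply continuous_const)
  have hSmeas : MeasurableSet S := by
    have hS : S = ⋃ N : ℕ, ⋂ n ≥ N,
        {x | l (fderiv ℝ (G^[n]) x v) < ((n : ℝ) + 1) ^ 2} := by
      ext x
      simp [S, eventually_atTop]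
    rw [hS]
    exact MeasurableSet.iUnion fun N => MeasurableSet.iInter fun n => MeasurableSet.iInter fun _ =>
      (isOpen_lt (hfcont n) continuous_const).measurableSet
  have hline : ∀ y : E, ∀ᵐ t : ℝ, y + t • v ∈ Wᶜ ∪ S := by
    intro y
    rw [ae_iff]
    refine measure_null_of_locally_null _ fun t₀ ht₀ => ?_
    have hγ : Continuous fun t : ℝ => y + t • v := by fun_prop
    have ht₀W : y + t₀ • v ∈ W := by
      by_contra h
      exact ht₀ (Or.inl h)
    obtain ⟨δ, hδ, hδW⟩ := Metric.nhds_basis_closedBall.mem_iff.1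
      ((hW.preimage hγ).mem_nhds ht₀W)
    rw [Real.closedBall_eq_Icc] at hδW
    have hle : t₀ - δ ≤ t₀ + δ := by linarith
    have hae := ae_eventually_lt_of_integral_le (B := 2 * (‖l‖ * R)) hle
      (g := fun n t => l (fderiv ℝ (G^[n]) (y + t • v) v)) (fun n => (hfcont n).comp hγ)
      (fun n t ht => (norm_nonneg _).trans
        (hl _ (hmaps _ (hδW (Ioc_subset_Icc_self ht)) n (interior_subset hv)))) (fun n => by
        have hderiv : ∀ t : ℝ, HasDerivAt (fun t : ℝ => l (G^[n] (y + t • v)))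
            (l (fderiv ℝ (G^[n]) (y + t • v) v)) t := by
          intro t
          have h1 : HasDerivAt (fun t : ℝ => y + t • v) v t := by
            simpa using ((hasDerivAt_id t).smul_const v).const_add y
          have h2 := ((hdiff.iterate n) (y + t • v)).hasFDerivAt.comp_hasDerivAt t h1
          exact l.hasFDerivAt.comp_hasDerivAt t h2
        rw [intervalIntegral.integral_eq_sub_of_hasDerivAt (fun t _ => hderiv t)
          (((hfcont n).comp hγ).intervalIntegrable _ _)]
        have hbound : ∀ t ∈ Icc (t₀ - δ) (t₀ + δ), |l (G^[n] (y + t • v))| ≤ ‖l‖ * R := by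
          intro t ht
          refine (l.le_opNorm _).trans ?_
          gcongr
          exact hR _ (horb _ (hδW ht) n)
        have h1 := abs_le.1 (hbound _ (right_mem_Icc.2 hle))
        have h2 := abs_le.1 (hbound _ (left_mem_Icc.2 hle))
        linarith [h1.2, h2.1])
    refine ⟨{t | ¬ (y + t • v ∈ Wᶜ ∪ S)} ∩ Ioc (t₀ - δ) (t₀ + δ), inter_mem self_mem_nhdsWithin
      (mem_nhdsWithin_of_mem_nhds (Ioc_mem_nhds (by linarith) (by linarith))), ?_⟩
    rw [← Measure.restrict_apply' measurableSet_Ioc, ← nonpos_iff_eq_zero]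
    refine (measure_mono ?_).trans_eq (ae_iff.1 hae)
    exact fun t ht hS => ht (Or.inr hS)
  have hae : ∀ᵐ x ∂μ, x ∈ Wᶜ ∪ S :=
    ae_mem_of_ae_add_linearMap_mem (LinearMap.toSpanSingleton ℝ E v) volume μ
      (hW.measurableSet.compl.union hSmeas) hline
  refine measure_mono_null ?_ (ae_iff.1 hae)
  rintro x ⟨hxW, hx⟩ (h | h)
  · exact h hxW
  · refine hx.not_ge (lambdaMax_nonpos_of_eventually_le (K := K) ?_)
    filter_upwards [h] with n hn
    exact (hnorm _ (hmaps x hxW n)).trans (by gcongr)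

end Exponent

section Perturbation

lemma iterate_mem_of_mapsTo {α : Type*} {G : α → α} {W O : Set α} {q : ℕ} (hq : 0 < q)
    (hW : MapsTo (G^[q]) W W) (hO : ∀ k ≤ q, ∀ x ∈ W, G^[k] x ∈ O) (k : ℕ) :
    ∀ x ∈ W, G^[k] x ∈ O := by
  intro x hx
  rw [← Nat.mod_add_div k q, Function.iterate_add_apply, Function.iterate_mul]
  exact hO _ (Nat.mod_lt _ hq).le _ (hW.iterate _ hx)

variable {E : Type*} [NormedAddCommGroup E]

/-- Finitely many iterates on a compact set depend continuously on the map. -/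
lemma exists_dist_iterate_lt {F : E → E} (hF : Continuous F) {K O : Set E} (hK : IsCompact K)
    (hO : IsOpen O) (hKO : ∀ k : ℕ, ∀ x ∈ K, F^[k] x ∈ O) (q : ℕ) {δ : ℝ} (hδ : 0 < δ) :
    ∃ η : ℝ, 0 < η ∧ ∀ G : E → E, (∀ x ∈ O, ‖G x - F x‖ < η) →
      ∀ k ≤ q, ∀ x ∈ K, G^[k] x ∈ O ∧ dist (G^[k] x) (F^[k] x) < δ := by
  induction q generalizing δ with
  | zero =>
    refine ⟨1, one_pos, fun G _ k hk x hx => ?_⟩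
    obtain rfl : k = 0 := by omega
    exact ⟨hKO 0 x hx, by simpa using hδ⟩
  | succ q ih =>
    have hL : ∀ k, IsCompact (F^[k] '' K) := fun k => hK.image (hF.iterate k)
    obtain ⟨δ₁, hδ₁, hsub⟩ := (hL (q + 1)).exists_thickening_subset_open hO (by
      rintro _ ⟨x, hx, rfl⟩
      exact hKO _ x hx)
    set δ₂ := min δ δ₁
    have hδ₂ : 0 < δ₂ := lt_min hδ hδ₁
    obtain ⟨ρ, hρ, hunif⟩ := Metric.mem_uniformity_dist.1
      ((hL q).uniformContinuousAt_of_continuousAt F (fun _ _ => hF.continuousAt)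
        (Metric.dist_mem_uniformity (half_pos hδ₂)))
    obtain ⟨η, hη, h⟩ := ih (lt_min hδ hρ)
    refine ⟨min η (δ₂ / 2), lt_min hη (half_pos hδ₂), fun G hG k hk x hx => ?_⟩
    have h' := h G fun x hx => (hG x hx).trans_le (min_le_left _ _)
    rcases Nat.lt_or_eq_of_le hk with hk | rfl
    · obtain ⟨h1, h2⟩ := h' k (by omega) x hx
      exact ⟨h1, h2.trans_le (min_le_left _ _)⟩
    · obtain ⟨h1, h2⟩ := h' q le_rfl x hx
      have h3 : dist (F (F^[q] x)) (F (G^[q] x)) < δ₂ / 2 :=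
        hunif (by rw [dist_comm]; exact h2.trans_le (min_le_right _ _)) (mem_image_of_mem _ hx)
      have h4 : dist (G (G^[q] x)) (F (G^[q] x)) < δ₂ / 2 := by
        rw [dist_eq_norm]
        exact (hG _ h1).trans_le (min_le_right _ _)
      have h5 : dist (G^[q + 1] x) (F^[q + 1] x) < δ₂ := by
        rw [Function.iterate_succ_apply', Function.iterate_succ_apply']
        have := dist_triangle_right (G (G^[q] x)) (F (F^[q] x)) (F (G^[q] x))
        linarith
      exact ⟨hsub (Metric.mem_thickening_iff.2
        ⟨_, mem_image_of_mem _ hx, h5.trans_le (min_le_right _ _)⟩), h5.trans_le (min_le_left _ _)⟩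

variable [NormedSpace ℝ E]

lemma IsAttractor.isConnected_thickening {F : E → E} (hF : Continuous F) {A : Set E}
    (hA : IsAttractor F A) {δ : ℝ} (hδ : 0 < δ) : IsConnected (thickening δ A) := by
  obtain ⟨hne, hcpt, hinv, hatt, -⟩ := hA
  obtain ⟨a, ha⟩ := hne
  obtain ⟨R, hR⟩ := hcpt.isBounded.subset_ball (0 : E)
  obtain ⟨N, hN⟩ := hatt _ isBounded_ball δ hδ
  have hAN : A ⊆ F^[N] '' ball 0 R := by
    have h : F^[N] '' A = A := by
      rw [image_iterate_eq]
      exact Function.iterate_fixed hinv N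
    calc A = F^[N] '' A := h.symm
      _ ⊆ _ := image_mono hR
  have hsub : F^[N] '' ball 0 R ⊆ thickening δ A := by
    rintro _ ⟨x, hx, rfl⟩
    exact (mem_thickening_iff_infDist_lt ⟨a, ha⟩).2 (hN N le_rfl x hx)
  have hpre : IsPreconnected (F^[N] '' ball (0 : E) R) :=
    (convex_ball (0 : E) R).isPreconnected.image _ (hF.iterate N).continuousOn
  refine ⟨⟨a, self_subset_thickening hδ A ha⟩, isPreconnected_of_forall a fun y hy => ?_⟩
  obtain ⟨z, hz, hyz⟩ := mem_thickening_iff.1 hy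
  exact ⟨F^[N] '' ball 0 R ∪ ball z δ, union_subset hsub (ball_subset_thickening hz δ),
    Or.inl (hAN ha), Or.inr hyz,
    hpre.union' ⟨z, hAN hz, mem_ball_self hδ⟩ (convex_ball z δ).isPreconnected⟩

/-- An attractor inside a bounded open set `O` has a connected trapping neighbourhood which
persists for all continuous maps close enough on `O`. -/
lemma IsAttractor.exists_robust_trapping [ProperSpace E] {F : E → E} (hF : Continuous F)
    {A O : Set E} (hA : IsAttractor F A) (hO : IsOpen O) (hOb : IsBounded O) (hAO : A ⊆ O) :
    ∃ (η : ℝ) (U W : Set E) (q : ℕ), 0 < η ∧ 0 < q ∧ IsOpen U ∧ IsConnected U ∧ IsBounded U ∧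
      A ⊆ U ∧ IsOpen W ∧ closure U ⊆ W ∧
      ∀ G : E → E, (∀ x ∈ O, ‖G x - F x‖ < η) →
        MapsTo (G^[q]) W U ∧ ∀ x ∈ W, ∀ k : ℕ, G^[k] x ∈ O := by
  have hA' := hA
  obtain ⟨hne, hcpt, hinv, hatt, -⟩ := hA
  obtain ⟨δ, hδ, hδO⟩ := hcpt.exists_thickening_subset_open hO hAO
  obtain ⟨N, hN⟩ := hatt O hOb δ hδ
  have hAinv : MapsTo F A A := fun x hx => hinv ▸ mem_image_of_mem F hx
  obtain ⟨δ₁, hδ₁, hK⟩ := hcpt.exists_cthickening_subset_open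
    (isOpen_biInter_finset (s := Finset.range (N + 1)) fun k _ => hO.preimage (hF.iterate k))
    (fun x hx => mem_iInter₂.2 fun k _ => hAO (hAinv.iterate k hx))
  have hKO' : ∀ k ≤ N, ∀ x ∈ cthickening δ₁ A, F^[k] x ∈ O := fun k hk x hx =>
    mem_iInter₂.1 (hK hx) k (Finset.mem_range.2 (by omega))
  have hKO : ∀ k : ℕ, ∀ x ∈ cthickening δ₁ A, F^[k] x ∈ O := by
    intro k x hx
    rcases le_total k N with hk | hk
    · exact hKO' k hk x hx
    · exact hδO ((mem_thickening_iff_infDist_lt hne).2 (hN k hk x (hKO' 0 N.zero_le x hx)))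
  obtain ⟨M, hM⟩ := hatt O hOb (δ₁ / 4) (by positivity)
  obtain ⟨η, hη, hclose⟩ := exists_dist_iterate_lt hF hcpt.cthickening hO hKO (M + 1)
    (show (0 : ℝ) < δ₁ / 4 by positivity)
  have hWK : thickening δ₁ A ⊆ cthickening δ₁ A := thickening_subset_cthickening _ _
  have hUW : thickening (δ₁ / 2) A ⊆ thickening δ₁ A := thickening_mono (by linarith) A
  refine ⟨η, thickening (δ₁ / 2) A, thickening δ₁ A, M + 1, hη, M.succ_pos, isOpen_thickening,
    hA'.isConnected_thickening hF (half_pos hδ₁), hcpt.isBounded.thickening,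
    self_subset_thickening (half_pos hδ₁) A, isOpen_thickening,
    (closure_thickening_subset_cthickening _ _).trans
      (cthickening_subset_thickening' hδ₁ (by linarith) A), fun G hG => ?_⟩
  have hmaps : MapsTo (G^[M + 1]) (thickening δ₁ A) (thickening (δ₁ / 2) A) := by
    intro x hx
    have h1 := (hclose G hG (M + 1) le_rfl x (hWK hx)).2
    have h2 := hM (M + 1) M.le_succ x (hKO 0 x (hWK hx))
    have h3 := infDist_le_infDist_add_dist (s := A) (x := G^[M + 1] x) (y := F^[M + 1] x)
    rw [mem_thickening_iff_infDist_lt hne]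
    linarith
  exact ⟨hmaps, fun x hx k => iterate_mem_of_mapsTo M.succ_pos (hmaps.mono_right hUW)
    (fun k hk x hx => (hclose G hG k hk x (hWK hx)).1) k x hx⟩

end Perturbation

/-- **Theorem B**, finite-dimensional form: `M` can be taken to be a compact domain
(the closure of a nonempty connected bounded open set) whose interior contains `A`,
and on `M` the set where `λ_max(·, F_ε) > 0` has Lebesgue measure zero. -/
theorem robust_no_observable_chaos_Rd
    {d : ℕ} (C : Set (EuclideanSpace ℝ (Fin d))) (hC : StronglyOrderedCone C)
    (F₀ : EuclideanSpace ℝ (Fin d) → EuclideanSpace ℝ (Fin d))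
    (hC1 : ContDiff ℝ 1 F₀)
    (hpos : ∀ x : EuclideanSpace ℝ (Fin d), StronglyPositive C (fderiv ℝ F₀ x))
    (hdiss : PointwiseDissipative F₀)
    (A : Set (EuclideanSpace ℝ (Fin d))) (hA : IsAttractor F₀ A)
    (ε₀ : ℝ) (hε₀ : 0 < ε₀) (F : ℝ → EuclideanSpace ℝ (Fin d) → EuclideanSpace ℝ (Fin d))
    (hFC1 : ContDiffOn ℝ 1 (fun p : ℝ × EuclideanSpace ℝ (Fin d) => F p.1 p.2)
      (Icc (-ε₀) ε₀ ×ˢ (univ : Set (EuclideanSpace ℝ (Fin d)))))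
    (c : EuclideanSpace ℝ (Fin d)) (r : ℝ) (hr : 0 < r) (hAball : A ⊆ ball c r) :
    ∃ η : ℝ, 0 < η ∧
      ((∀ ε ∈ Icc (-ε₀) ε₀, ∀ x ∈ ball c r,
          ‖F ε x - F₀ x‖ + ‖fderiv ℝ (F ε) x - fderiv ℝ F₀ x‖ < η) →
        ∃ (M : Set (EuclideanSpace ℝ (Fin d))) (q : ℕ) (ε₁ : ℝ),
          (∃ U : Set (EuclideanSpace ℝ (Fin d)), IsOpen U ∧ IsConnected U ∧ IsBounded U ∧ M = closure U) ∧
          A ⊆ interior M ∧ 0 < q ∧ 0 < ε₁ ∧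
            ∀ ε ∈ Ioo (-ε₁) ε₁,
              (F ε)^[q] '' M ⊆ M ∧
                volume {x : EuclideanSpace ℝ (Fin d) | x ∈ M ∧ 0 < lambdaMax (F ε) x} = 0) := by
  have hCo := hC.1
  obtain ⟨η₁, U, W, q, hη₁, hq, hU, hUc, hUb, hAU, hW, hUW, htrap⟩ :=
    hA.exists_robust_trapping hC1.continuous isOpen_ball isBounded_ball hAball
  obtain ⟨η₂, hη₂, hcone⟩ := exists_mapsTo_cone_of_close hCo (hC1.continuous_fderiv one_ne_zero)
    (isCompact_closedBall c r) (fun x _ => hpos x)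
  refine ⟨min η₁ η₂, lt_min hη₁ hη₂, fun hclose => ⟨closure U, q, ε₀, ⟨U, hU, hUc, hUb, rfl⟩,
    hAU.trans (interior_maximal subset_closure hU), hq, hε₀, fun ε hε => ?_⟩⟩
  have hε' : ε ∈ Icc (-ε₀) ε₀ := Ioo_subset_Icc_self hε
  have hGC1 : ContDiff ℝ 1 (F ε) := by
    rw [← contDiffOn_univ]
    exact hFC1.comp (contDiff_const.prodMk contDiff_id).contDiffOn fun x _ => ⟨hε', mem_univ x⟩
  obtain ⟨hmaps, horb⟩ := htrap (F ε) fun x hx =>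
    (le_add_of_nonneg_right (norm_nonneg _)).trans_lt
      ((hclose ε hε' x hx).trans_le (min_le_left _ _))
  refine ⟨image_subset_iff.2 fun x hx => subset_closure (hmaps (hUW hx)), ?_⟩
  have hnull := volume_lambdaMax_pos_eq_zero (μ := volume) hC hGC1 hW isBounded_ball horb
    fun x hx => hcone x (ball_subset_closedBall hx) _
      ((le_add_of_nonneg_left (norm_nonneg _)).trans_lt
        ((hclose ε hε' x hx).trans_le (min_le_right _ _)))
  refine measure_mono_null ?_ hnull
  exact fun x hx => ⟨hUW hx.1, hx.2⟩

end
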